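/- Let T ⊂ V be a 3-dimensional ℝ-linear subspace with ℂ·T = V and ⟨t,t'⟩ ∈ ℝ for all t,t' ∈ T, and let P := ℙ(T) = {[t] | 0 ≠ t ∈ T} be the corresponding ℝ-plane. Then W := {h : V → V ℂ-linear | tr h = 0, h* = h, and ⟨h t, t⟩ = 0 for all t ∈ T} satisfies: dim_ℝ W = 3, every nonzero h ∈ W has rank exactly 2 (in particular det h = 0), and the base of W equals P, i.e., {[v] ∈ ℙ(V) | ⟨h v, v⟩ = 0 for all h ∈ W} = P. -/

import Mathlib

open scoped ComplexConjugate

noncomputable section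

/-- `V` is `ℂ³`. -/
abbrev V3 : Type := Fin 3 → ℂ

/-- The hermitian form of signature `(2,1)`:
`⟨x,y⟩ = x₀·conj y₀ + x₁·conj y₁ − x₂·conj y₂`. -/
def herm (x y : V3) : ℂ := x 0 * conj (y 0) + x 1 * conj (y 1) - x 2 * conj (y 2)

/-- The complex projective plane `ℙ(V)`. -/
abbrev PV : Type := Projectivization ℂ V3

/-- The class `[v]` of a nonzero vector `v` in `ℙ(V)`. -/
def projMk (v : V3) (hv : v ≠ 0) : PV := Projectivization.mk ℂ v hv

/-- A map `h` is self-adjoint (`h* = h`) w.r.t. the hermitian form. -/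
def SelfAdj (h : Module.End ℂ V3) : Prop := ∀ x y : V3, herm (h x) y = herm x (h y)

/-- The set `B_h = {[v] ∈ ℙ(V) | ⟨h v, v⟩ = 0}`. -/
def Bset (h : Module.End ℂ V3) : Set PV :=
  {q | ∃ v : V3, ∃ hv : v ≠ 0, q = projMk v hv ∧ herm (h v) v = 0}

/-- `h` defines a bisector: self-adjoint, trace `0`, rank `2`, and `B_h` contains
a point other than the focus (i.e. a point `[v]` with `h v ≠ 0`). -/
def IsBisector (h : Module.End ℂ V3) : Prop :=
  SelfAdj h ∧ LinearMap.trace ℂ V3 h = 0 ∧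
    Module.finrank ℂ (LinearMap.range h) = 2 ∧ ∃ v : V3, herm (h v) v = 0 ∧ h v ≠ 0

/-- A linear family of bisectors: an `ℝ`-subspace of self-adjoint traceless
degenerate maps whose base contains a negative point. -/
def IsLinearFamily (W : Submodule ℝ (Module.End ℂ V3)) : Prop :=
  (∀ h ∈ W, SelfAdj h ∧ LinearMap.trace ℂ V3 h = 0 ∧ LinearMap.det h = 0) ∧
    ∃ v : V3, ∃ hv : v ≠ 0, (herm v v).re < 0 ∧ ∀ h ∈ W, herm (h v) v = 0

/-- The map `x ↦ ⟨x,p⟩·p`. -/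
def wmap (p : V3) : Module.End ℂ V3 where
  toFun x := herm x p • p
  map_add' x y := by
    show herm (x + y) p • p = herm x p • p + herm y p • p
    have : herm (x + y) p = herm x p + herm y p := by
      simp only [herm, Pi.add_apply]; ring
    rw [this, add_smul]
  map_smul' c x := by
    show herm (c • x) p • p = c • (herm x p • p)
    have : herm (c • x) p = c * herm x p := by
      simp only [herm, Pi.smul_apply, smul_eq_mul]; ring
    rw [this, mul_smul]

/-- `ℙ(U)` for a complex subspace `U`. -/
def projC (U : Submodule ℂ V3) : Set PV :=
  {q | ∃ v : V3, ∃ hv : v ≠ 0, v ∈ U ∧ q = projMk v hv}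

/-- `ℙ(T)` for a real subspace `T`. -/
def projR (T : Submodule ℝ V3) : Set PV :=
  {q | ∃ v : V3, ∃ hv : v ≠ 0, v ∈ T ∧ q = projMk v hv}

/-- An `ℝ`-plane: `ℙ(T)` for a totally real `3`-dimensional real subspace `T`
with `ℂ·T = V`. -/
def IsRealPlane (T : Submodule ℝ V3) : Prop :=
  Module.finrank ℝ T = 3 ∧ Submodule.span ℂ (T : Set V3) = ⊤ ∧
    ∀ t ∈ T, ∀ t' ∈ T, (herm t t').im = 0

/-- A geodesic: `ℙ(W₀)` for a `2`-dimensional real subspace `W₀` on which the form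
is real-valued and not identically zero. -/
def IsGeodesic (W₀ : Submodule ℝ V3) : Prop :=
  Module.finrank ℝ W₀ = 2 ∧ (∀ w ∈ W₀, ∀ w' ∈ W₀, (herm w w').im = 0) ∧
    ∃ w ∈ W₀, ∃ w' ∈ W₀, herm w w' ≠ 0

/-- The real spine `R = {[h v] | [v] ∈ B_h, h v ≠ 0}` of `B_h`. -/
def RealSpine (h : Module.End ℂ V3) : Set PV :=
  {q | ∃ v : V3, ∃ hnz : h v ≠ 0, herm (h v) v = 0 ∧ q = projMk (h v) hnz}

/-- The orthogonal complement w.r.t. the hermitian form. -/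
def hermOrth (U : Submodule ℂ V3) : Submodule ℂ V3 where
  carrier := {x | ∀ u ∈ U, herm x u = 0}
  add_mem' := by
    intro a b ha hb u hu
    have h1 : herm (a + b) u = herm a u + herm b u := by
      simp only [herm, Pi.add_apply]; ring
    rw [h1, ha u hu, hb u hu, add_zero]
  zero_mem' := by
    intro u hu
    simp [herm]
  smul_mem' := by
    intro c x hx u hu
    have h1 : herm (c • x) u = c * herm x u := by
      simp only [herm, Pi.smul_apply, smul_eq_mul]; ring
    rw [h1, hx u hu, mul_zero]


theorem herm_add_left (x y z : V3) : herm (x + y) z = herm x z + herm y z := by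
  simp only [herm, Pi.add_apply]; ring

theorem herm_add_right (x y z : V3) : herm x (y + z) = herm x y + herm x z := by
  simp only [herm, Pi.add_apply, map_add]; ring

theorem herm_smul_left (c : ℂ) (x y : V3) : herm (c • x) y = c * herm x y := by
  simp only [herm, Pi.smul_apply, smul_eq_mul]; ring

theorem herm_smul_right (c : ℂ) (x y : V3) : herm x (c • y) = conj c * herm x y := by
  simp only [herm, Pi.smul_apply, smul_eq_mul, map_mul]; ring

theorem herm_conj (x y : V3) : conj (herm x y) = herm y x := by
  simp only [herm, map_add, map_sub, map_mul, Complex.conj_conj]; ring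

theorem eq_zero_of_herm_right {x : V3} (hx : ∀ y, herm x y = 0) : x = 0 := by
  funext i
  have h := hx (Pi.single i 1)
  fin_cases i <;> simpa [herm] using h

theorem eq_zero_of_herm_left {y : V3} (hy : ∀ x, herm x y = 0) : y = 0 :=
  eq_zero_of_herm_right fun x => by rw [← herm_conj, hy, map_zero]

/-- A real basis of an `ℝ`-plane is a complex basis of `V`. -/
theorem IsRealPlane.exists_basis {T : Submodule ℝ V3} (hT : IsRealPlane T) :
    ∃ b : Module.Basis (Fin 3) ℂ V3, ∀ i, b i ∈ T := by
  obtain ⟨hfin, hspan, -⟩ := hT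
  have : Module.Finite ℝ T := Module.finite_of_finrank_pos (by omega)
  let e := Module.finBasisOfFinrankEq ℝ T hfin
  let t : Fin 3 → V3 := fun i => (e i : V3)
  have htop : ⊤ ≤ Submodule.span ℂ (Set.range t) := by
    rw [← hspan, Submodule.span_le]
    intro x hx
    have hsum := congrArg (Subtype.val : T → V3) (e.sum_repr ⟨x, hx⟩)
    rw [← show _ = x from hsum, Submodule.coe_sum]
    refine Submodule.sum_mem _ fun i _ => ?_
    have hsmul : ((e.repr ⟨x, hx⟩ i • e i : T) : V3) = ((e.repr ⟨x, hx⟩ i : ℝ) : ℂ) • t i := by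
      ext j; simp [t]
    rw [hsmul]
    exact Submodule.smul_mem _ _ (Submodule.subset_span ⟨i, rfl⟩)
  refine ⟨basisOfTopLeSpanOfCardEqFinrank t htop (by simp), fun i => ?_⟩
  simp [t]

/-- The skew-type map `x ↦ i(⟨x,a⟩b − ⟨x,b⟩a)`. -/
def skewMap (a b : V3) : Module.End ℂ V3 where
  toFun x := (Complex.I * herm x a) • b - (Complex.I * herm x b) • a
  map_add' x y := by
    simp only [herm_add_left, mul_add, add_smul]; abel
  map_smul' c x := by
    simp only [herm_smul_left, RingHom.id_apply, smul_sub, smul_smul]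
    congr 2 <;> ring

theorem skewMap_apply (a b x : V3) :
    skewMap a b x = (Complex.I * herm x a) • b - (Complex.I * herm x b) • a := rfl

theorem selfAdj_skewMap (a b : V3) : SelfAdj (skewMap a b) := by
  intro x y
  simp only [skewMap_apply, sub_eq_add_neg, ← neg_smul, herm_add_left, herm_add_right,
    herm_smul_left, herm_smul_right, map_mul, map_neg, herm_conj, Complex.conj_I]
  ring

theorem trace_skewMap (a b : V3) :
    LinearMap.trace ℂ V3 (skewMap a b) = Complex.I * (herm b a - herm a b) := by
  rw [LinearMap.trace_eq_matrix_trace ℂ (Pi.basisFun ℂ (Fin 3))]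
  simp [Matrix.trace, Fin.sum_univ_three, skewMap_apply, herm]
  ring

/-- The traceless self-adjoint maps whose quadratic form vanishes on `T`, as a predicate on `W`. -/
def IsFamilyThrough (T : Submodule ℝ V3) (W : Submodule ℝ (Module.End ℂ V3)) : Prop :=
  ∀ h : Module.End ℂ V3, h ∈ W ↔
    (LinearMap.trace ℂ V3 h = 0 ∧ SelfAdj h ∧ ∀ t ∈ T, herm (h t) t = 0)

theorem IsRealPlane.herm_comm {T : Submodule ℝ V3} (hT : IsRealPlane T) {t t' : V3}
    (ht : t ∈ T) (ht' : t' ∈ T) : herm t' t = herm t t' := by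
  rw [← herm_conj, Complex.conj_eq_iff_im.2 (hT.2.2 t ht t' ht')]

namespace IsFamilyThrough

variable {T : Submodule ℝ V3} {W : Submodule ℝ (Module.End ℂ V3)}

theorem skewMap_mem (hW : IsFamilyThrough T W) (hT : IsRealPlane T) {a b : V3}
    (ha : a ∈ T) (hb : b ∈ T) : skewMap a b ∈ W := by
  refine (hW _).2 ⟨?_, selfAdj_skewMap a b, fun t ht => ?_⟩
  · rw [trace_skewMap, hT.herm_comm ha hb, sub_self, mul_zero]
  · rw [skewMap_apply, sub_eq_add_neg, ← neg_smul, herm_add_left, herm_smul_left, herm_smul_left,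
      hT.herm_comm ht ha, hT.herm_comm ht hb]
    ring

/-- The matrix of `⟨h ·, ·⟩` on `T` is antisymmetric. -/
theorem herm_swap (hW : IsFamilyThrough T W) {h : Module.End ℂ V3} (hh : h ∈ W) {t t' : V3}
    (ht : t ∈ T) (ht' : t' ∈ T) : herm (h t') t = -herm (h t) t' := by
  obtain ⟨-, -, hz⟩ := (hW h).1 hh
  have hs := hz (t + t') (T.add_mem ht ht')
  rw [map_add, herm_add_left, herm_add_right, herm_add_right, hz t ht, hz t' ht'] at hs
  linear_combination hs

/-- The matrix of `⟨h ·, ·⟩` on `T` is purely imaginary. -/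
theorem herm_eq_I_mul (hW : IsFamilyThrough T W) {h : Module.End ℂ V3} (hh : h ∈ W) {t t' : V3}
    (ht : t ∈ T) (ht' : t' ∈ T) : herm (h t) t' = Complex.I * ((herm (h t) t').im : ℂ) := by
  have hc : conj (herm (h t) t') = -herm (h t) t' := by
    rw [herm_conj, ← ((hW h).1 hh).2.1, hW.herm_swap hh ht ht']
  have hre := congrArg Complex.re hc
  simp only [Complex.conj_re, Complex.neg_re] at hre
  apply Complex.ext <;> simp
  linarith

end IsFamilyThrough

theorem eq_zero_of_herm_basis (b : Module.Basis (Fin 3) ℂ V3) {x : V3}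
    (hx : ∀ k, herm x (b k) = 0) : x = 0 := by
  refine eq_zero_of_herm_right fun y => ?_
  rw [← b.sum_repr y, Fin.sum_univ_three]
  simp [herm_add_right, herm_smul_right, hx]

/-- The coordinates of `h ∈ W`: the entries above the diagonal of the antisymmetric matrix
`Im ⟨h bⱼ, bₖ⟩`. -/
def skewCoord (b : Fin 3 → V3) : Module.End ℂ V3 →ₗ[ℝ] (Fin 3 → ℝ) where
  toFun h := ![(herm (h (b 1)) (b 2)).im, (herm (h (b 2)) (b 0)).im, (herm (h (b 0)) (b 1)).im]
  map_add' h g := by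
    ext i; fin_cases i <;> simp [herm_add_left]
  map_smul' c h := by
    have hs (x y : V3) : herm (c • x) y = c * herm x y := by
      simp only [herm, Pi.smul_apply, Complex.real_smul]; ring
    ext i; fin_cases i <;> simp [hs]

/-- The real combinations of the maps `skewMap (b j) (b k)`. -/
def skewComb (b : Fin 3 → V3) : (Fin 3 → ℝ) →ₗ[ℝ] Module.End ℂ V3 where
  toFun c := c 0 • skewMap (b 1) (b 2) + c 1 • skewMap (b 2) (b 0) + c 2 • skewMap (b 0) (b 1)
  map_add' c d := by
    simp only [Pi.add_apply, add_smul]; abel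
  map_smul' r c := by
    simp only [Pi.smul_apply, smul_eq_mul, mul_smul, smul_add, RingHom.id_apply]

theorem skewComb_injective (b : Module.Basis (Fin 3) ℂ V3) :
    Function.Injective (skewComb b) := by
  rw [← LinearMap.ker_eq_bot, LinearMap.ker_eq_bot']
  intro c hc
  have hx (x : V3) :
      (Complex.I * (c 1 * herm x (b 2) - c 2 * herm x (b 1))) • b 0
        + (Complex.I * (c 2 * herm x (b 0) - c 0 * herm x (b 2))) • b 1
        + (Complex.I * (c 0 * herm x (b 1) - c 1 * herm x (b 0))) • b 2 = 0 := by
    rw [← show skewComb b c x = 0 by rw [hc]; rfl]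
    ext i
    simp [skewComb, skewMap_apply]
    ring
  have hcoef (x : V3) := Fintype.linearIndependent_iff.1 b.linearIndependent
    ![_, _, _] (by simpa [Fin.sum_univ_three] using hx x)
  have hdual (p q : ℝ) (j k : Fin 3) (hjk : j ≠ k)
      (hpq : ∀ x, Complex.I * (p * herm x (b j) - q * herm x (b k)) = 0) : p = 0 ∧ q = 0 := by
    have h0 : (p : ℂ) • b j - (q : ℂ) • b k = 0 := by
      refine eq_zero_of_herm_left fun x => ?_
      rw [sub_eq_add_neg, ← neg_smul, herm_add_right, herm_smul_right, herm_smul_right]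
      have := (mul_eq_zero.1 (hpq x)).resolve_left Complex.I_ne_zero
      simp only [map_neg, Complex.conj_ofReal]
      linear_combination this
    have hr := congrArg b.repr h0
    simp only [map_sub, map_smul, Module.Basis.repr_self, map_zero] at hr
    constructor
    · simpa [hjk, hjk.symm] using DFunLike.congr_fun hr j
    · simpa [hjk, hjk.symm] using DFunLike.congr_fun hr k
  have h0 := hdual _ _ 2 1 (by decide) fun x => by simpa using hcoef x 0
  have h1 := hdual _ _ 0 2 (by decide) fun x => by simpa using hcoef x 1
  ext i; fin_cases i
  exacts [h1.2, h0.1, h0.2]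

namespace IsFamilyThrough

variable {T : Submodule ℝ V3} {W : Submodule ℝ (Module.End ℂ V3)}

/-- The values `⟨h v, bₖ⟩` in terms of the coordinates of `v` and `h`. -/
theorem herm_apply_basis (hW : IsFamilyThrough T W) {b : Module.Basis (Fin 3) ℂ V3}
    (hb : ∀ i, b i ∈ T) {h : Module.End ℂ V3} (hh : h ∈ W) (v : V3) :
    herm (h v) (b 0) = Complex.I * (b.repr v 2 * skewCoord b h 1 - b.repr v 1 * skewCoord b h 2) ∧
    herm (h v) (b 1) = Complex.I * (b.repr v 0 * skewCoord b h 2 - b.repr v 2 * skewCoord b h 0) ∧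
    herm (h v) (b 2) = Complex.I * (b.repr v 1 * skewCoord b h 0 - b.repr v 0 * skewCoord b h 1) := by
  have hd (k) : herm (h (b k)) (b k) = 0 := ((hW h).1 hh).2.2 _ (hb k)
  have h0 : herm (h (b 1)) (b 2) = Complex.I * skewCoord b h 0 := hW.herm_eq_I_mul hh (hb _) (hb _)
  have h1 : herm (h (b 2)) (b 0) = Complex.I * skewCoord b h 1 := hW.herm_eq_I_mul hh (hb _) (hb _)
  have h2 : herm (h (b 0)) (b 1) = Complex.I * skewCoord b h 2 := hW.herm_eq_I_mul hh (hb _) (hb _)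
  have hv (y : V3) : herm (h v) y = b.repr v 0 * herm (h (b 0)) y + b.repr v 1 * herm (h (b 1)) y
      + b.repr v 2 * herm (h (b 2)) y := by
    conv_lhs => rw [← b.sum_repr v]
    simp only [Fin.sum_univ_three, map_add, map_smul, herm_add_left, herm_smul_left]
  refine ⟨?_, ?_, ?_⟩ <;> rw [hv, hd]
  · rw [hW.herm_swap hh (hb 0) (hb 1), h1, h2]; ring
  · rw [hW.herm_swap hh (hb 1) (hb 2), h0, h2]; ring
  · rw [hW.herm_swap hh (hb 2) (hb 0), h0, h1]; ring

theorem apply_eq_zero_iff (hW : IsFamilyThrough T W) {b : Module.Basis (Fin 3) ℂ V3}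
    (hb : ∀ i, b i ∈ T) {h : Module.End ℂ V3} (hh : h ∈ W) (v : V3) :
    h v = 0 ↔ b.repr v 2 * skewCoord b h 1 = b.repr v 1 * skewCoord b h 2 ∧
      b.repr v 0 * skewCoord b h 2 = b.repr v 2 * skewCoord b h 0 ∧
      b.repr v 1 * skewCoord b h 0 = b.repr v 0 * skewCoord b h 1 := by
  obtain ⟨h0, h1, h2⟩ := hW.herm_apply_basis hb hh v
  constructor
  · intro hv
    have hz (y : V3) : herm (h v) y = 0 := by simp [hv, herm]
    rw [hz, eq_comm, mul_eq_zero, or_iff_right Complex.I_ne_zero, sub_eq_zero] at h0 h1 h2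
    exact ⟨h0, h1, h2⟩
  · rintro ⟨e0, e1, e2⟩
    refine eq_zero_of_herm_basis b fun k => ?_
    fin_cases k
    · simpa [e0] using h0
    · simpa [e1] using h1
    · simpa [e2] using h2

theorem skewCoord_injective (hW : IsFamilyThrough T W) {b : Module.Basis (Fin 3) ℂ V3}
    (hb : ∀ i, b i ∈ T) : Function.Injective ((skewCoord b).domRestrict W) := by
  refine (injective_iff_map_eq_zero _).2 ?_
  rintro ⟨h, hh⟩ hc
  have hc' : skewCoord b h = 0 := hc
  ext1
  refine LinearMap.ext fun v => (hW.apply_eq_zero_iff hb hh v).2 ?_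
  simp [hc']

theorem finrank_eq (hW : IsFamilyThrough T W) (hT : IsRealPlane T) : Module.finrank ℝ W = 3 := by
  obtain ⟨b, hb⟩ := hT.exists_basis
  have hinj := hW.skewCoord_injective hb
  have : Module.Finite ℝ W := Module.Finite.of_injective _ hinj
  have hmem (c : Fin 3 → ℝ) : skewComb b c ∈ W :=
    W.add_mem (W.add_mem (W.smul_mem _ (hW.skewMap_mem hT (hb _) (hb _)))
      (W.smul_mem _ (hW.skewMap_mem hT (hb _) (hb _))))
      (W.smul_mem _ (hW.skewMap_mem hT (hb _) (hb _)))
  have hinj' : Function.Injective ((skewComb b).codRestrict W hmem) := fun c d hcd =>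
    skewComb_injective b (congrArg Subtype.val hcd)
  apply le_antisymm
  · simpa using LinearMap.finrank_le_finrank_of_injective hinj
  · simpa using LinearMap.finrank_le_finrank_of_injective hinj'

theorem finrank_range (hW : IsFamilyThrough T W) (hT : IsRealPlane T) {h : Module.End ℂ V3}
    (hh : h ∈ W) (h0 : h ≠ 0) : Module.finrank ℂ (LinearMap.range h) = 2 := by
  obtain ⟨b, hb⟩ := hT.exists_basis
  let u : V3 := b.equivFun.symm fun i => (skewCoord b h i : ℂ)
  have hu (i) : b.repr u i = skewCoord b h i := congrFun (b.equivFun.apply_symm_apply _) i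
  have hne : skewCoord b h ≠ 0 := fun hc => h0 <|
    congrArg Subtype.val <| hW.skewCoord_injective hb (a₁ := ⟨h, hh⟩) (a₂ := 0) (by simpa using hc)
  obtain ⟨i, hi⟩ := Function.ne_iff.1 hne
  have hi' : (skewCoord b h i : ℂ) ≠ 0 := Complex.ofReal_ne_zero.2 hi
  have hu0 : u ≠ 0 := fun hu' => hi' (by rw [← hu i, hu']; simp)
  have hker : LinearMap.ker h = Submodule.span ℂ {u} := by
    ext v
    rw [LinearMap.mem_ker, hW.apply_eq_zero_iff hb hh, Submodule.mem_span_singleton]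
    constructor
    · rintro ⟨e0, e1, e2⟩
      refine ⟨b.repr v i / skewCoord b h i, b.ext_elem fun j => ?_⟩
      rw [map_smul, Finsupp.smul_apply, smul_eq_mul, hu, div_mul_eq_mul_div, div_eq_iff hi']
      fin_cases i <;> fin_cases j <;> simp only [Fin.mk_one, Fin.zero_eta, Fin.reduceFinMk] <;>
        first | exact e0 | exact e1 | exact e2 | exact e0.symm | exact e1.symm | exact e2.symm
    · rintro ⟨c, rfl⟩
      simp only [map_smul, Finsupp.smul_apply, smul_eq_mul, hu]
      refine ⟨?_, ?_, ?_⟩ <;> ring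
  have hrank := h.finrank_range_add_finrank_ker
  rw [hker, finrank_span_singleton hu0, Module.finrank_fin_fun] at hrank
  omega

/-- A point of the base has a representative in `T`. -/
theorem exists_smul_mem (hW : IsFamilyThrough T W) (hT : IsRealPlane T) {v : V3} (hv : v ≠ 0)
    (hbase : ∀ h ∈ W, herm (h v) v = 0) : ∃ c : ℂ, c ≠ 0 ∧ c • v ∈ T := by
  obtain ⟨b, hb⟩ := hT.exists_basis
  have hinj := hW.skewCoord_injective hb
  have : Module.Finite ℝ W := Module.Finite.of_injective _ hinj
  have hdim : Module.finrank ℝ W = Module.finrank ℝ (Fin 3 → ℝ) := by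
    rw [hW.finrank_eq hT, Module.finrank_fin_fun]
  have hsurj : Function.Surjective ((skewCoord b).domRestrict W) :=
    (LinearMap.injective_iff_surjective_of_finrank_eq_finrank (V := W)
      (f := (skewCoord b).domRestrict W) hdim).1 hinj
  set z := b.repr v with hz
  have key (c : Fin 3 → ℝ) : conj (z 0) * (z 2 * c 1 - z 1 * c 2)
      + conj (z 1) * (z 0 * c 2 - z 2 * c 0) + conj (z 2) * (z 1 * c 0 - z 0 * c 1) = 0 := by
    obtain ⟨⟨h, hh⟩, hc⟩ := hsurj c
    replace hc : skewCoord b h = c := hc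
    obtain ⟨h0, h1, h2⟩ := hW.herm_apply_basis hb hh v
    have hq := hbase h hh
    have hexp (x : V3) : herm x v = conj (z 0) * herm x (b 0) + conj (z 1) * herm x (b 1)
        + conj (z 2) * herm x (b 2) := by
      conv_lhs => rw [← b.sum_repr v]
      simp only [Fin.sum_univ_three, herm_add_right, herm_smul_right, hz]
    rw [hexp, h0, h1, h2, hc] at hq
    refine (mul_eq_zero.1 ?_).resolve_left Complex.I_ne_zero
    linear_combination hq
  have e0 := key ![1, 0, 0]
  have e1 := key ![0, 1, 0]
  have e2 := key ![0, 0, 1]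
  simp at e0 e1 e2
  have hreal (i j : Fin 3) : conj (conj (z i) * z j) = conj (z i) * z j := by
    rw [map_mul, Complex.conj_conj]
    fin_cases i <;> fin_cases j <;> simp only [Fin.mk_one, Fin.zero_eta, Fin.reduceFinMk] <;>
      first
        | ring1
        | linear_combination e0
        | linear_combination e1
        | linear_combination e2
        | linear_combination -e0
        | linear_combination -e1
        | linear_combination -e2
  obtain ⟨i, hi⟩ : ∃ i, z i ≠ 0 := by
    by_contra! hall
    exact hv (b.ext_elem fun i => by simpa using hall i)
  refine ⟨conj (z i), by simpa using hi, ?_⟩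
  rw [← b.sum_repr v, Finset.smul_sum]
  refine T.sum_mem fun j _ => ?_
  rw [smul_smul, ← hz, ← Complex.conj_eq_iff_re.1 (hreal i j), Complex.coe_smul]
  exact T.smul_mem _ (hb j)

end IsFamilyThrough

/-- Lemma 4.4.1: the family of bisectors through an `ℝ`-plane `P = ℙ(T)`
is `3`-dimensional, consists of rank-`2` maps, and has base exactly `P`. -/
theorem stmt_8 (T : Submodule ℝ V3) (hT : IsRealPlane T)
    (W : Submodule ℝ (Module.End ℂ V3))
    (hWdef : ∀ h : Module.End ℂ V3, h ∈ W ↔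
      (LinearMap.trace ℂ V3 h = 0 ∧ SelfAdj h ∧ ∀ t ∈ T, herm (h t) t = 0)) :
    Module.finrank ℝ W = 3 ∧
      (∀ h ∈ W, h ≠ 0 → Module.finrank ℂ (LinearMap.range h) = 2) ∧
      {q : PV | ∃ v : V3, ∃ hv : v ≠ 0, q = projMk v hv ∧ ∀ h ∈ W, herm (h v) v = 0}
        = projR T := by
  have hW : IsFamilyThrough T W := hWdef
  refine ⟨hW.finrank_eq hT, fun h hh h0 => hW.finrank_range hT hh h0, ?_⟩
  ext q
  constructor
  · rintro ⟨v, hv, rfl, hbase⟩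
    obtain ⟨c, hc, hcv⟩ := hW.exists_smul_mem hT hv hbase
    exact ⟨c • v, smul_ne_zero hc hv, hcv,
      (Projectivization.mk_eq_mk_iff' ℂ _ _ _ _).2 ⟨c⁻¹, inv_smul_smul₀ hc v⟩⟩
  · rintro ⟨v, hv, hvT, rfl⟩
    exact ⟨v, hv, rfl, fun h hh => ((hW h).1 hh).2.2 v hvT⟩

end
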